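/- arXiv:1812.03439 — 2 statements merged into one kernel-verified Lean document; each statement's English description precedes it below -/
import Mathlib

section
/- Let H be a quasi-Hopf algebra over a field k with bijective antipode S (inverse S̄) and Drinfeld twist f with inverse f̄1⊗f̄2. On H define h ▷ a = h_(1) a S(h_(2)), the product a ⋆ b = φ1 a S(φ̄1 φ2) α φ̄2 φ3_(1) b S(φ̄3 φ3_(2)), and the first-kind coaction δ¹(a) = φ1 φ'1_(1) a_(1) f̄1 S(q^R_2 φ'2_(2)) φ'3 ⊗ φ2 φ'1_(2) a_(2) f̄2 S(φ3 q^R_1 φ'2_(1)), where φ' is an independent copy of φ; write δ¹(a) = a_⟨-1⟩ ⊗ a_⟨0⟩. Then the adjoint algebra is quantum commutative: (a_⟨-1⟩ ▷ b) ⋆ a_⟨0⟩ = a ⋆ b for all a, b ∈ H. -/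
open scoped TensorProduct

noncomputable section

/-- A quasi-Hopf algebra over a field `k`, presented together with explicit
(Sweedler-style) finite representations of the comultiplication and of the
associator `φ` and its inverse `φ⁻¹`.  The fields `n, d1, d2` give, for every
`h : H`, a finite family with `Δ h = ∑ i < n h, d1 h i ⊗ d2 h i`; similarly
`P1, P2, P3` (resp. `Q1, Q2, Q3`) are the components of `φ` (resp. `φ⁻¹`). -/
structure QuasiHopf (k H : Type) [Field k] [Ring H] [Algebra k H] where
  comul : H →ₐ[k] H ⊗[k] H
  counit : H →ₐ[k] k
  n : H → ℕ
  d1 : H → ℕ → H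
  d2 : H → ℕ → H
  comul_eq : ∀ h, comul h = ∑ i ∈ Finset.range (n h), d1 h i ⊗ₜ[k] d2 h i
  np : ℕ
  P1 : ℕ → H
  P2 : ℕ → H
  P3 : ℕ → H
  nq : ℕ
  Q1 : ℕ → H
  Q2 : ℕ → H
  Q3 : ℕ → H
  S : H →ₗ[k] H
  Sinv : H →ₗ[k] H
  alpha : H
  beta : H
  S_one : S 1 = 1
  S_mul : ∀ x y : H, S (x * y) = S y * S x
  Sinv_S : ∀ x : H, Sinv (S x) = x
  S_Sinv : ∀ x : H, S (Sinv x) = x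
  phi_phiInv :
    (∑ a ∈ Finset.range np, P1 a ⊗ₜ[k] (P2 a ⊗ₜ[k] P3 a)) *
      (∑ b ∈ Finset.range nq, Q1 b ⊗ₜ[k] (Q2 b ⊗ₜ[k] Q3 b)) = 1
  phiInv_phi :
    (∑ b ∈ Finset.range nq, Q1 b ⊗ₜ[k] (Q2 b ⊗ₜ[k] Q3 b)) *
      (∑ a ∈ Finset.range np, P1 a ⊗ₜ[k] (P2 a ⊗ₜ[k] P3 a)) = 1
  qcoassoc : ∀ h : H,
    ∑ i ∈ Finset.range (n h), d1 h i ⊗ₜ[k] comul (d2 h i) =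
      (∑ a ∈ Finset.range np, P1 a ⊗ₜ[k] (P2 a ⊗ₜ[k] P3 a)) *
        (∑ i ∈ Finset.range (n h), ∑ j ∈ Finset.range (n (d1 h i)),
          d1 (d1 h i) j ⊗ₜ[k] (d2 (d1 h i) j ⊗ₜ[k] d2 h i)) *
        (∑ b ∈ Finset.range nq, Q1 b ⊗ₜ[k] (Q2 b ⊗ₜ[k] Q3 b))
  counit_left : ∀ h : H, ∑ i ∈ Finset.range (n h), counit (d1 h i) • d2 h i = h
  counit_right : ∀ h : H, ∑ i ∈ Finset.range (n h), counit (d2 h i) • d1 h i = h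
  pentagon :
    (∑ a ∈ Finset.range np, P1 a ⊗ₜ[k] (P2 a ⊗ₜ[k] comul (P3 a))) *
      (∑ a ∈ Finset.range np, ∑ i ∈ Finset.range (n (P1 a)),
        d1 (P1 a) i ⊗ₜ[k] (d2 (P1 a) i ⊗ₜ[k] (P2 a ⊗ₜ[k] P3 a))) =
    ((1 : H) ⊗ₜ[k] (∑ a ∈ Finset.range np, P1 a ⊗ₜ[k] (P2 a ⊗ₜ[k] P3 a))) *
      (∑ a ∈ Finset.range np, ∑ i ∈ Finset.range (n (P2 a)),
        P1 a ⊗ₜ[k] (d1 (P2 a) i ⊗ₜ[k] (d2 (P2 a) i ⊗ₜ[k] P3 a))) *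
      (∑ a ∈ Finset.range np, P1 a ⊗ₜ[k] (P2 a ⊗ₜ[k] (P3 a ⊗ₜ[k] (1 : H))))
  counit_mid_phi :
    ∑ a ∈ Finset.range np, counit (P2 a) • (P1 a ⊗ₜ[k] P3 a) = (1 : H) ⊗ₜ[k] (1 : H)
  antipode_alpha : ∀ h : H,
    ∑ i ∈ Finset.range (n h), S (d1 h i) * alpha * d2 h i = counit h • alpha
  antipode_beta : ∀ h : H,
    ∑ i ∈ Finset.range (n h), d1 h i * beta * S (d2 h i) = counit h • beta
  nondeg_1 : ∑ a ∈ Finset.range np, P1 a * beta * S (P2 a) * alpha * P3 a = 1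
  nondeg_2 : ∑ b ∈ Finset.range nq, S (Q1 b) * alpha * Q2 b * beta * S (Q3 b) = 1
  counit_alpha : counit alpha = 1
  counit_beta : counit beta = 1

namespace QuasiHopf

variable {k H : Type} [Field k] [Ring H] [Algebra k H] (q : QuasiHopf k H)

/-- The associator `φ` as an element of `H ⊗ H ⊗ H`. -/
def Phi : H ⊗[k] (H ⊗[k] H) :=
  ∑ a ∈ Finset.range q.np, q.P1 a ⊗ₜ[k] (q.P2 a ⊗ₜ[k] q.P3 a)

/-- `φ⁻¹` as an element of `H ⊗ H ⊗ H`. -/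
def PhiInv : H ⊗[k] (H ⊗[k] H) :=
  ∑ b ∈ Finset.range q.nq, q.Q1 b ⊗ₜ[k] (q.Q2 b ⊗ₜ[k] q.Q3 b)

/-- first components of `p^R = φ̄1 ⊗ φ̄2 β S(φ̄3)` -/
def pR1 (b : ℕ) : H := q.Q1 b

def pR2 (b : ℕ) : H := q.Q2 b * q.beta * q.S (q.Q3 b)

def pRE : H ⊗[k] H := ∑ b ∈ Finset.range q.nq, q.pR1 b ⊗ₜ[k] q.pR2 b

/-- components of `q^R = φ1 ⊗ S̄(α φ3) φ2` -/
def qR1 (a : ℕ) : H := q.P1 a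

def qR2 (a : ℕ) : H := q.Sinv (q.alpha * q.P3 a) * q.P2 a

def qRE : H ⊗[k] H := ∑ a ∈ Finset.range q.np, q.qR1 a ⊗ₜ[k] q.qR2 a

/-- components of `p^L = φ2 S̄(φ1 β) ⊗ φ3` -/
def pL1 (a : ℕ) : H := q.P2 a * q.Sinv (q.P1 a * q.beta)

def pL2 (a : ℕ) : H := q.P3 a

def pLE : H ⊗[k] H := ∑ a ∈ Finset.range q.np, q.pL1 a ⊗ₜ[k] q.pL2 a

/-- components of `q^L = S(φ̄1) α φ̄2 ⊗ φ̄3` -/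
def qL1 (b : ℕ) : H := q.S (q.Q1 b) * q.alpha * q.Q2 b

def qL2 (b : ℕ) : H := q.Q3 b

def qLE : H ⊗[k] H := ∑ b ∈ Finset.range q.nq, q.qL1 b ⊗ₜ[k] q.qL2 b

/-- `𝕒 = S(φ̄1 φ2) α φ̄2 φ3₍₁₎ ⊗ S(φ1) α φ̄3 φ3₍₂₎` -/
def aEl : H ⊗[k] H :=
  ∑ a ∈ Finset.range q.np, ∑ b ∈ Finset.range q.nq, ∑ m ∈ Finset.range (q.n (q.P3 a)),
    (q.S (q.Q1 b * q.P2 a) * q.alpha * q.Q2 b * q.d1 (q.P3 a) m) ⊗ₜ[k]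
      (q.S (q.P1 a) * q.alpha * q.Q3 b * q.d2 (q.P3 a) m)

/-- `𝕓 = φ1₍₁₎ φ̄1 β S(φ3) ⊗ φ1₍₂₎ φ̄2 β S(φ2 φ̄3)` -/
def bEl : H ⊗[k] H :=
  ∑ a ∈ Finset.range q.np, ∑ b ∈ Finset.range q.nq, ∑ m ∈ Finset.range (q.n (q.P1 a)),
    (q.d1 (q.P1 a) m * q.Q1 b * q.beta * q.S (q.P3 a)) ⊗ₜ[k]
      (q.d2 (q.P1 a) m * q.Q2 b * q.beta * q.S (q.P2 a * q.Q3 b))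

/-- `(S ⊗ S)(Δ^cop x) = S(x₍₂₎) ⊗ S(x₍₁₎)` -/
def scop (x : H) : H ⊗[k] H :=
  ∑ m ∈ Finset.range (q.n x), q.S (q.d2 x m) ⊗ₜ[k] q.S (q.d1 x m)

/-- The Drinfeld twist `f = (S⊗S)(Δ^cop(p^R_1)) · 𝕒 · Δ(p^R_2)`. -/
def twist : H ⊗[k] H :=
  ∑ b ∈ Finset.range q.nq, q.scop (q.pR1 b) * q.aEl * q.comul (q.pR2 b)

/-- `f⁻¹ = Δ(q^L_1) · 𝕓 · (S⊗S)(Δ^cop(q^L_2))`. -/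
def twistInv : H ⊗[k] H :=
  ∑ b ∈ Finset.range q.nq, q.comul (q.qL1 b) * q.bEl * q.scop (q.qL2 b)

/-- `x ⊗ y ↦ S y ⊗ S x` -/
def sswap : H ⊗[k] H →ₗ[k] H ⊗[k] H :=
  (TensorProduct.map q.S q.S).comp (TensorProduct.comm k H H).toLinearMap

/-- `x ⊗ y ↦ S̄ y ⊗ S̄ x` -/
def sswapInv : H ⊗[k] H →ₗ[k] H ⊗[k] H :=
  (TensorProduct.map q.Sinv q.Sinv).comp (TensorProduct.comm k H H).toLinearMap

/-- `U^L = f̄1 S(q^R_2) ⊗ f̄2 S(q^R_1)` -/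
def UL : H ⊗[k] H := q.twistInv * q.sswap q.qRE

/-- `V^L = S̄(f2 p^R_2) ⊗ S̄(f1 p^R_1)` -/
def VL : H ⊗[k] H := q.sswapInv (q.twist * q.pRE)

/-- `U^R = S̄(q^L_2 f̄2) ⊗ S̄(q^L_1 f̄1)` -/
def UR : H ⊗[k] H := q.sswapInv (q.qLE * q.twistInv)

/-- `V^R = S(p^L_2) f1 ⊗ S(p^L_1) f2` -/
def VR : H ⊗[k] H := q.sswap q.pLE * q.twist

/-- `h ↦ h ↼ μ = μ(h₍₁₎) h₍₂₎` -/
def lhook (mu : H →ₐ[k] k) : H →ₗ[k] H :=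
  (TensorProduct.lid k H).toLinearMap.comp
    ((TensorProduct.map mu.toLinearMap LinearMap.id).comp q.comul.toLinearMap)

/-- `h ↦ μ ⇀ h = μ(h₍₂₎) h₍₁₎` -/
def rhook (mu : H →ₐ[k] k) : H →ₗ[k] H :=
  (TensorProduct.rid k H).toLinearMap.comp
    ((TensorProduct.map LinearMap.id mu.toLinearMap).comp q.comul.toLinearMap)

/-- `W^L = μ(φ̄1) f̄1 S(q^R_2 φ̄3) ⊗ f̄2 S((q^R_1 ↼ μ) φ̄2)` -/
def WL (mu : H →ₐ[k] k) : H ⊗[k] H :=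
  q.twistInv * q.sswap ((TensorProduct.map (q.lhook mu) LinearMap.id q.qRE) *
    (∑ b ∈ Finset.range q.nq, mu (q.Q1 b) • (q.Q2 b ⊗ₜ[k] q.Q3 b)))

/-- `W^R = μ(φ3) S̄((μ ⇀ q^L_2) φ2 f̄2) ⊗ S̄(q^L_1 φ1 f̄1)` -/
def WR (mu : H →ₐ[k] k) : H ⊗[k] H :=
  q.sswapInv ((TensorProduct.map LinearMap.id (q.rhook mu) q.qLE) *
    (∑ a ∈ Finset.range q.np, mu (q.P3 a) • (q.P1 a ⊗ₜ[k] q.P2 a)) * q.twistInv)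

section Modules

variable {V W X : Type} [AddCommGroup V] [Module k V] [AddCommGroup W] [Module k W]
  [AddCommGroup X] [Module k X]

/-- The tensor-product action `h · (v ⊗ w) = h₍₁₎ v ⊗ h₍₂₎ w`. -/
def tensAct (ρV : H → Module.End k V) (ρW : H → Module.End k W) (h : H) :
    Module.End k (V ⊗[k] W) :=
  ∑ i ∈ Finset.range (q.n h), TensorProduct.map (ρV (q.d1 h i)) (ρW (q.d2 h i))

/-- The action on the left dual: `(h · ξ)(x) = ξ(S(h) x)`. -/
def dualAct (ρX : H → Module.End k X) (h : H) : Module.End k (Module.Dual k X) :=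
  LinearMap.dualMap (ρX (q.S h))

end Modules

end QuasiHopf

/-- `f` intertwines the two given `H`-actions. -/
def IsHLin {k H V W : Type} [Field k] [Ring H] [Algebra k H]
    [AddCommGroup V] [Module k V] [AddCommGroup W] [Module k W]
    (ρV : H → Module.End k V) (ρW : H → Module.End k W) (f : V →ₗ[k] W) : Prop :=
  ∀ (h : H) (v : V), f (ρV h v) = ρW h (f v)

/-- `x ⊗ y ↦ λ(y) • x` -/
def hitR {k H : Type} [Field k] [Ring H] [Algebra k H] (lam : H →ₗ[k] k) :
    H ⊗[k] H →ₗ[k] H :=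
  (TensorProduct.rid k H).toLinearMap.comp (TensorProduct.map LinearMap.id lam)

/-- `x ⊗ y ↦ λ(x) • y` -/
def hitL {k H : Type} [Field k] [Ring H] [Algebra k H] (lam : H →ₗ[k] k) :
    H ⊗[k] H →ₗ[k] H :=
  (TensorProduct.lid k H).toLinearMap.comp (TensorProduct.map lam LinearMap.id)

namespace QuasiHopf

variable {k H : Type} [Field k] [Ring H] [Algebra k H] (q : QuasiHopf k H)

/-- The adjoint action `h ▷ a = h₍₁₎ a S(h₍₂₎)`. -/
def ad (h a : H) : H := ∑ i ∈ Finset.range (q.n h), q.d1 h i * a * q.S (q.d2 h i)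

/-- The multiplication `a ⋆ b = φ1 a S(φ̄1 φ2) α φ̄2 φ3₍₁₎ b S(φ̄3 φ3₍₂₎)` of the
adjoint algebra. -/
def star (a b : H) : H :=
  ∑ c ∈ Finset.range q.np, ∑ e ∈ Finset.range q.nq, ∑ m ∈ Finset.range (q.n (q.P3 c)),
    q.P1 c * a * q.S (q.Q1 e * q.P2 c) * q.alpha * q.Q2 e * q.d1 (q.P3 c) m * b *
      q.S (q.Q3 e * q.d2 (q.P3 c) m)

/-- The first-kind Yetter–Drinfeld coaction of the adjoint algebra:
`δ¹(a) = φ1 φ'1₍₁₎ a₍₁₎ f̄1 S(q^R_2 φ'2₍₂₎) φ'3 ⊗ φ2 φ'1₍₂₎ a₍₂₎ f̄2 S(φ3 q^R_1 φ'2₍₁₎)`. -/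
def deltaOne (a : H) : H ⊗[k] H :=
  ∑ c ∈ Finset.range q.np, ∑ c' ∈ Finset.range q.np, ∑ e ∈ Finset.range q.np,
    ∑ m1 ∈ Finset.range (q.n (q.P1 c')), ∑ m2 ∈ Finset.range (q.n (q.P2 c')),
      ((q.P1 c * q.d1 (q.P1 c') m1) ⊗ₜ[k] (q.P2 c * q.d2 (q.P1 c') m1)) *
        q.comul a * q.twistInv *
        ((q.S (q.qR2 e * q.d2 (q.P2 c') m2) * q.P3 c') ⊗ₜ[k]
          (q.S (q.P3 c * q.qR1 e * q.d1 (q.P2 c') m2)))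

end QuasiHopf

namespace QuasiHopf

set_option maxSynthPendingDepth 5

open TensorProduct Algebra.TensorProduct

variable {k H : Type} [Field k] [Ring H] [Algebra k H] (q : QuasiHopf k H)

/-- Induction on threefold tensors. -/
theorem tensor_induction₃ {P : H ⊗[k] (H ⊗[k] H) → Prop}
    (hadd : ∀ s t, P s → P t → P (s + t)) (hpure : ∀ x y z, P (x ⊗ₜ (y ⊗ₜ z)))
    (t : H ⊗[k] (H ⊗[k] H)) : P t := by
  have h0 : P 0 := by simpa using hpure 0 0 0
  induction t with
  | zero => exact h0
  | add s t hs ht => exact hadd s t hs ht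
  | tmul x s =>
    induction s with
    | zero => simpa using h0
    | add s t hs ht => rw [TensorProduct.tmul_add]; exact hadd _ _ hs ht
    | tmul y z => exact hpure x y z

/-- Induction on fourfold tensors. -/
theorem tensor_induction₄ {P : H ⊗[k] (H ⊗[k] (H ⊗[k] H)) → Prop}
    (hadd : ∀ s t, P s → P t → P (s + t))
    (hpure : ∀ x y z w, P (x ⊗ₜ (y ⊗ₜ (z ⊗ₜ w))))
    (t : H ⊗[k] (H ⊗[k] (H ⊗[k] H))) : P t := by
  have h0 : P 0 := by simpa using hpure 0 0 0 0
  induction t with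
  | zero => exact h0
  | add s t hs ht => exact hadd s t hs ht
  | tmul x s =>
    induction s using tensor_induction₃ with
    | hadd s t hs ht => rw [TensorProduct.tmul_add]; exact hadd _ _ hs ht
    | hpure y z w => exact hpure x y z w

/-! ### Coproducts and counits on tensor factors -/

section Legs

variable {A B : Type} [Ring A] [Algebra k A] [Ring B] [Algebra k B]

/-- `Δ ⊗ id` on `H ⊗ A`. -/
def comulFst : H ⊗[k] A →ₐ[k] H ⊗[k] (H ⊗[k] A) :=
  (Algebra.TensorProduct.assoc k k k H H A).toAlgHom.comp
    (Algebra.TensorProduct.map q.comul (AlgHom.id k A))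

/-- `id ⊗ f` on `H ⊗ A`. -/
def idTensor (f : A →ₐ[k] B) : H ⊗[k] A →ₐ[k] H ⊗[k] B :=
  Algebra.TensorProduct.map (AlgHom.id k H) f

/-- `ε ⊗ id` on `H ⊗ A`. -/
def counitFst : H ⊗[k] A →ₐ[k] A :=
  (Algebra.TensorProduct.lid k A).toAlgHom.comp
    (Algebra.TensorProduct.map q.counit (AlgHom.id k A))

/-- `id ⊗ ε` on `A ⊗ H`. -/
def counitSnd : A ⊗[k] H →ₐ[k] A :=
  (Algebra.TensorProduct.rid k k A).toAlgHom.comp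
    (Algebra.TensorProduct.map (AlgHom.id k A) q.counit)

theorem comulFst_tmul (x : H) (a : A) :
    q.comulFst (x ⊗ₜ a) = Algebra.TensorProduct.assoc k k k H H A (q.comul x ⊗ₜ a) := rfl

theorem comulFst_tmul_sum (x : H) (a : A) :
    q.comulFst (x ⊗ₜ a) =
      ∑ i ∈ Finset.range (q.n x), q.d1 x i ⊗ₜ (q.d2 x i ⊗ₜ[k] a) := by
  simp [comulFst_tmul, q.comul_eq, TensorProduct.sum_tmul]

@[simp] theorem idTensor_tmul (f : A →ₐ[k] B) (x : H) (a : A) :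
    idTensor f (x ⊗ₜ[k] a) = x ⊗ₜ f a := rfl

@[simp] theorem counitFst_tmul (x : H) (a : A) :
    q.counitFst (x ⊗ₜ a) = q.counit x • a := rfl

@[simp] theorem counitSnd_tmul (x : H) (a : A) :
    q.counitSnd (a ⊗ₜ x) = q.counit x • a := rfl

theorem counitFst_comul (h : H) : q.counitFst (q.comul h) = h := by
  simpa [q.comul_eq] using q.counit_left h

theorem counitSnd_comul (h : H) : q.counitSnd (q.comul h) = h := by
  simpa [q.comul_eq] using q.counit_right h

end Legs

/-! ### The axioms in terms of the leg maps -/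

theorem Phi_mul_PhiInv : q.Phi * q.PhiInv = 1 := q.phi_phiInv

theorem PhiInv_mul_Phi : q.PhiInv * q.Phi = 1 := q.phiInv_phi

theorem map_Phi_mul_PhiInv {A : Type} [Ring A] [Algebra k A] (f : H ⊗[k] (H ⊗[k] H) →ₐ[k] A) :
    f q.Phi * f q.PhiInv = 1 := by
  rw [← map_mul, Phi_mul_PhiInv, map_one]

theorem map_PhiInv_mul_Phi {A : Type} [Ring A] [Algebra k A] (f : H ⊗[k] (H ⊗[k] H) →ₐ[k] A) :
    f q.PhiInv * f q.Phi = 1 := by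
  rw [← map_mul, PhiInv_mul_Phi, map_one]

theorem map_PhiInv_eq_one {A : Type} [Ring A] [Algebra k A] (f : H ⊗[k] (H ⊗[k] H) →ₐ[k] A)
    (hf : f q.Phi = 1) : f q.PhiInv = 1 := by
  simpa [hf] using q.map_Phi_mul_PhiInv f

theorem comul_coassoc (h : H) :
    idTensor q.comul (q.comul h) * q.Phi = q.Phi * q.comulFst (q.comul h) := by
  have h1 : idTensor q.comul (q.comul h) = q.Phi * q.comulFst (q.comul h) * q.PhiInv := by
    simpa [q.comul_eq h, comulFst_tmul_sum, Phi, PhiInv] using q.qcoassoc h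
  rw [h1, mul_assoc, PhiInv_mul_Phi, mul_one]

theorem comul_coassoc_inv (h : H) :
    q.PhiInv * idTensor q.comul (q.comul h) = q.comulFst (q.comul h) * q.PhiInv := by
  have h1 : q.PhiInv * (idTensor q.comul (q.comul h) * q.Phi) * q.PhiInv =
      q.PhiInv * (q.Phi * q.comulFst (q.comul h)) * q.PhiInv := by rw [comul_coassoc]
  simpa only [mul_assoc, Phi_mul_PhiInv, mul_one, ← mul_assoc q.PhiInv q.Phi, PhiInv_mul_Phi,
    one_mul] using h1

/-- The map `x ⊗ y ⊗ z ↦ x ⊗ y ⊗ z ⊗ 1`. -/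
def tmulOne : H ⊗[k] (H ⊗[k] H) →ₐ[k] H ⊗[k] (H ⊗[k] (H ⊗[k] H)) :=
  idTensor (idTensor includeLeft)

@[simp] theorem tmulOne_tmul (x y z : H) :
    tmulOne (x ⊗ₜ[k] (y ⊗ₜ[k] z)) = x ⊗ₜ[k] (y ⊗ₜ[k] (z ⊗ₜ[k] (1 : H))) := rfl

/-- The map `t ↦ 1 ⊗ t`. -/
def oneTmul : H ⊗[k] (H ⊗[k] H) →ₐ[k] H ⊗[k] (H ⊗[k] (H ⊗[k] H)) := includeRight

@[simp] theorem oneTmul_apply (t : H ⊗[k] (H ⊗[k] H)) : oneTmul t = (1 : H) ⊗ₜ[k] t := rfl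

theorem pentagon_legs :
    idTensor (idTensor q.comul) q.Phi * q.comulFst q.Phi =
      oneTmul q.Phi * idTensor q.comulFst q.Phi * tmulOne q.Phi := by
  simpa [Phi, comulFst_tmul_sum, TensorProduct.tmul_sum] using q.pentagon

theorem counit_mid_Phi : idTensor q.counitFst q.Phi = 1 := by
  simpa [Phi, Algebra.TensorProduct.one_def] using q.counit_mid_phi

theorem counitFst_comulFst {A : Type} [Ring A] [Algebra k A] (t : H ⊗[k] A) :
    q.counitFst (q.comulFst t) = t := by
  induction t with
  | zero => simp
  | add s t hs ht => simp [hs, ht]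
  | tmul x a =>
    conv_rhs => rw [← q.counitFst_comul x]
    rw [comulFst_tmul]
    generalize q.comul x = e
    induction e with
    | zero => simp
    | add s t hs ht => simp [TensorProduct.add_tmul, hs, ht]
    | tmul y z => simp [TensorProduct.smul_tmul']

theorem counit_fst_Phi : q.counitFst q.Phi = 1 := by
  have hpent := congrArg (q.counitFst.comp q.counitFst) q.pentagon_legs
  have h1 (t : H ⊗[k] (H ⊗[k] H)) :
      q.counitFst (q.counitFst (idTensor (idTensor q.comul) t)) =
        q.comul (q.counitFst (q.counitFst t)) := by
    induction t using tensor_induction₃ with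
    | hadd s t hs ht => simp [hs, ht]
    | hpure x y z => simp
  have h2 (t : H ⊗[k] (H ⊗[k] H)) :
      q.counitFst (q.counitFst (idTensor q.comulFst t)) = q.counitFst t := by
    induction t using tensor_induction₃ with
    | hadd s t hs ht => simp [hs, ht]
    | hpure x y z => simp [counitFst_comulFst]
  have h3 (t : H ⊗[k] (H ⊗[k] H)) :
      q.counitFst (q.counitFst (tmulOne t)) =
        (includeLeft : H →ₐ[k] H ⊗[k] H) (q.counitFst (q.counitFst t)) := by
    induction t using tensor_induction₃ with
    | hadd s t hs ht => simp only [map_add, hs, ht]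
    | hpure x y z => simp [TensorProduct.smul_tmul']
  have h4 (t : H ⊗[k] (H ⊗[k] H)) :
      q.counitFst (q.counitFst t) = q.counitFst (idTensor q.counitFst t) := by
    induction t using tensor_induction₃ with
    | hadd s t hs ht => simp [hs, ht]
    | hpure x y z => simp [smul_comm (q.counit x)]
  have h5 : q.counitFst (q.counitFst q.Phi) = 1 := by rw [h4, counit_mid_Phi, map_one]
  simp only [AlgHom.comp_apply, map_mul, h1, h2, h3, h5, counitFst_comulFst, map_one, one_mul,
    mul_one, oneTmul_apply, counitFst_tmul, one_smul] at hpent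
  have h6 := congrArg (· * q.counitFst q.PhiInv) hpent
  simpa [mul_assoc, map_Phi_mul_PhiInv] using h6.symm

theorem counit_thd_Phi : idTensor q.counitSnd q.Phi = 1 := by
  have hpent := congrArg (idTensor (q.counitSnd.comp (idTensor q.counitSnd))) q.pentagon_legs
  have h1 (t : H ⊗[k] (H ⊗[k] H)) :
      idTensor (q.counitSnd.comp (idTensor q.counitSnd)) (idTensor (idTensor q.comul) t) =
        idTensor q.counitSnd t := by
    induction t using tensor_induction₃ with
    | hadd s t hs ht => simp only [map_add, hs, ht]
    | hpure x y z => simp [counitSnd_comul]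
  have h2 (t : H ⊗[k] (H ⊗[k] H)) :
      idTensor (q.counitSnd.comp (idTensor q.counitSnd)) (q.comulFst t) =
        q.comul (q.counitSnd (idTensor q.counitSnd t)) := by
    induction t using tensor_induction₃ with
    | hadd s t hs ht => simp only [map_add, hs, ht]
    | hpure x y z =>
      simp only [comulFst_tmul, idTensor_tmul, counitSnd_tmul, map_smul]
      generalize q.comul x = e
      induction e with
      | zero => simp
      | add s t hs ht => simp [TensorProduct.add_tmul, hs, ht]
      | tmul y z => simp [smul_smul, mul_comm]
  have h3 (t : H ⊗[k] (H ⊗[k] H)) :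
      idTensor (q.counitSnd.comp (idTensor q.counitSnd)) (oneTmul t) =
        (1 : H) ⊗ₜ[k] q.counitSnd (idTensor q.counitSnd t) := by
    induction t using tensor_induction₃ with
    | hadd s t hs ht => simp only [map_add, hs, ht, TensorProduct.tmul_add]
    | hpure x y z => simp
  have h4 (t : H ⊗[k] (H ⊗[k] H)) :
      idTensor (q.counitSnd.comp (idTensor q.counitSnd)) (idTensor q.comulFst t) =
        idTensor q.counitSnd t := by
    induction t using tensor_induction₃ with
    | hadd s t hs ht => simp only [map_add, hs, ht]
    | hpure x y z =>
      simp only [idTensor_tmul, comulFst_tmul]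
      conv_rhs => rw [← q.counitSnd_comul y]
      generalize q.comul y = e
      induction e with
      | zero => simp
      | add s t hs ht => simp_all [TensorProduct.add_tmul, TensorProduct.tmul_add]
      | tmul y z => simp [smul_smul]
  have h5 (t : H ⊗[k] (H ⊗[k] H)) :
      idTensor (q.counitSnd.comp (idTensor q.counitSnd)) (tmulOne t) =
        idTensor q.counitSnd t := by
    induction t using tensor_induction₃ with
    | hadd s t hs ht => simp only [map_add, hs, ht]
    | hpure x y z => simp
  have h6 (t : H ⊗[k] (H ⊗[k] H)) :
      q.counitSnd (idTensor q.counitSnd t) = q.counitSnd (idTensor q.counitFst t) := by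
    induction t using tensor_induction₃ with
    | hadd s t hs ht => simp only [map_add, hs, ht]
    | hpure x y z => simp [smul_comm (q.counit z)]
  have h7 : q.counitSnd (idTensor q.counitSnd q.Phi) = 1 := by rw [h6, counit_mid_Phi, map_one]
  simp only [map_mul, h1, h2, h3, h4, h5, h7, map_one, mul_one,
    ← Algebra.TensorProduct.one_def, one_mul] at hpent
  have h8 := congrArg (· * idTensor q.counitSnd q.PhiInv) hpent
  simpa [mul_assoc, map_Phi_mul_PhiInv] using h8.symm

/-! ### Antipode contractions -/

/-- `x ⊗ y ↦ S(x) α y` -/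
def alphaContr : H ⊗[k] H →ₗ[k] H :=
  LinearMap.mul' k H ∘ₗ TensorProduct.map q.S (LinearMap.mulLeft k q.alpha)

/-- `x ⊗ y ↦ x β S(y)` -/
def betaContr : H ⊗[k] H →ₗ[k] H :=
  LinearMap.mul' k H ∘ₗ TensorProduct.map (LinearMap.mulRight k q.beta) q.S

@[simp] theorem alphaContr_tmul (x y : H) : q.alphaContr (x ⊗ₜ y) = q.S x * (q.alpha * y) := rfl

@[simp] theorem betaContr_tmul (x y : H) : q.betaContr (x ⊗ₜ y) = x * q.beta * q.S y := rfl

theorem alphaContr_comul (h : H) : q.alphaContr (q.comul h) = q.counit h • q.alpha := by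
  simpa [q.comul_eq h, mul_assoc] using q.antipode_alpha h

theorem betaContr_comul (h : H) : q.betaContr (q.comul h) = q.counit h • q.beta := by
  simpa [q.comul_eq h] using q.antipode_beta h

/-- `x ⊗ y ⊗ t ↦ S(x) α y ⊗ t` -/
def alphaFst {A : Type} [Ring A] [Algebra k A] : H ⊗[k] (H ⊗[k] A) →ₗ[k] H ⊗[k] A :=
  TensorProduct.map q.alphaContr LinearMap.id ∘ₗ (TensorProduct.assoc k H H A).symm.toLinearMap

@[simp] theorem alphaFst_tmul {A : Type} [Ring A] [Algebra k A] (x y : H) (a : A) :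
    q.alphaFst (x ⊗ₜ (y ⊗ₜ a)) = (q.S x * (q.alpha * y)) ⊗ₜ[k] a := rfl

theorem alphaFst_comulFst_mul {A : Type} [Ring A] [Algebra k A] (t : H ⊗[k] A)
    (s : H ⊗[k] (H ⊗[k] A)) :
    q.alphaFst (q.comulFst t * s) = ((1 : H) ⊗ₜ[k] q.counitFst t) * q.alphaFst s := by
  induction t with
  | zero => simp
  | add t t' ht ht' => simp [add_mul, TensorProduct.tmul_add, ht, ht']
  | tmul x a =>
    induction s with
    | zero => simp
    | add s s' hs hs' => simp [mul_add, hs, hs']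
    | tmul y s =>
      induction s with
      | zero => simp
      | add s s' hs hs' => simp [mul_add, TensorProduct.tmul_add, hs, hs']
      | tmul z c =>
        have h (e : H ⊗[k] H) :
            q.alphaFst (Algebra.TensorProduct.assoc k k k H H A (e ⊗ₜ a) * (y ⊗ₜ (z ⊗ₜ c))) =
              (q.S y * (q.alphaContr e * z)) ⊗ₜ[k] (a * c) := by
          induction e with
          | zero => simp
          | add e e' he he' => simp [TensorProduct.add_tmul, add_mul, mul_add, he, he']
          | tmul v w => simp [q.S_mul, mul_assoc]
        rw [comulFst_tmul, h, alphaContr_comul]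
        simp [TensorProduct.smul_tmul']

/-- `x ⊗ y ⊗ z ⊗ w ↦ x ⊗ S(y) α z S(w)` -/
def starContr : H ⊗[k] (H ⊗[k] (H ⊗[k] H)) →ₗ[k] H ⊗[k] H :=
  TensorProduct.map LinearMap.id (LinearMap.mul' k H ∘ₗ TensorProduct.map q.S
    (LinearMap.mulLeft k q.alpha ∘ₗ LinearMap.mul' k H ∘ₗ TensorProduct.map LinearMap.id q.S))

@[simp] theorem starContr_tmul (x y z w : H) :
    q.starContr (x ⊗ₜ (y ⊗ₜ (z ⊗ₜ w))) = x ⊗ₜ (q.S y * (q.alpha * (z * q.S w))) := rfl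

/-- `x ⊗ z ↦ x ⊗ 1 ⊗ 1 ⊗ z` -/
def insertMid : H ⊗[k] H →ₐ[k] H ⊗[k] (H ⊗[k] (H ⊗[k] H)) :=
  idTensor (includeRight.comp includeRight)

@[simp] theorem insertMid_tmul (x z : H) :
    insertMid (x ⊗ₜ[k] z) = x ⊗ₜ[k] ((1 : H) ⊗ₜ[k] ((1 : H) ⊗ₜ[k] z)) := rfl

/-- `x ⊗ y ↦ x ⊗ y ⊗ 1 ⊗ 1` -/
def insertEnd : H ⊗[k] H →ₐ[k] H ⊗[k] (H ⊗[k] (H ⊗[k] H)) :=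
  idTensor includeLeft

@[simp] theorem insertEnd_tmul (x y : H) :
    insertEnd (x ⊗ₜ[k] y) = x ⊗ₜ[k] (y ⊗ₜ[k] ((1 : H) ⊗ₜ[k] (1 : H))) := rfl

theorem starContr_comulMid_mul (t : H ⊗[k] (H ⊗[k] H)) (s : H ⊗[k] (H ⊗[k] (H ⊗[k] H))) :
    q.starContr (idTensor q.comulFst t * s) =
      q.starContr (insertMid (idTensor q.counitFst t) * s) := by
  induction t using tensor_induction₃ with
  | hadd t t' ht ht' => simp only [map_add, add_mul, ht, ht']
  | hpure x y z =>
    induction s using tensor_induction₄ with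
    | hadd s s' hs hs' => simp only [map_add, mul_add, hs, hs']
    | hpure a b c d =>
      have h (e : H ⊗[k] H) :
          q.starContr ((x ⊗ₜ Algebra.TensorProduct.assoc k k k H H H (e ⊗ₜ z)) *
              (a ⊗ₜ (b ⊗ₜ (c ⊗ₜ d)))) =
            (x * a) ⊗ₜ[k] (q.S b * (q.alphaContr e * (c * q.S (z * d)))) := by
        induction e with
        | zero => simp
        | add e e' he he' =>
          simp only [TensorProduct.add_tmul, TensorProduct.tmul_add, map_add, add_mul, mul_add,
            he, he']
        | tmul v w => simp [q.S_mul, mul_assoc]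
      rw [idTensor_tmul, comulFst_tmul, h, alphaContr_comul]
      simp

theorem starContr_mul_comulEnd (t : H ⊗[k] (H ⊗[k] H)) (s : H ⊗[k] (H ⊗[k] (H ⊗[k] H))) :
    q.starContr (s * idTensor (idTensor q.comul) t * (1 ⊗ₜ (1 ⊗ₜ (q.beta ⊗ₜ 1)))) =
      q.starContr (s * insertEnd (idTensor q.counitSnd t) * (1 ⊗ₜ (1 ⊗ₜ (q.beta ⊗ₜ 1)))) := by
  induction t using tensor_induction₃ with
  | hadd t t' ht ht' => simp only [map_add, add_mul, mul_add, ht, ht']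
  | hpure x y z =>
    induction s using tensor_induction₄ with
    | hadd s s' hs hs' => simp only [map_add, add_mul, hs, hs']
    | hpure a b c d =>
      have h (e : H ⊗[k] H) :
          q.starContr ((a ⊗ₜ (b ⊗ₜ (c ⊗ₜ d))) * (x ⊗ₜ (y ⊗ₜ e)) *
              (1 ⊗ₜ (1 ⊗ₜ (q.beta ⊗ₜ 1)))) =
            (a * x) ⊗ₜ[k] (q.S (b * y) * (q.alpha * (c * (q.betaContr e * q.S d)))) := by
        induction e with
        | zero => simp
        | add e e' he he' =>
          simp only [TensorProduct.tmul_add, map_add, add_mul, mul_add, he, he']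
        | tmul v w => simp [q.S_mul, mul_assoc]
      rw [idTensor_tmul, idTensor_tmul, h, betaContr_comul]
      simp [mul_assoc]

/-- `x ⊗ y ⊗ z ⊗ w ↦ x ⊗ y β S(z) α w` -/
def snakeContr : H ⊗[k] (H ⊗[k] (H ⊗[k] H)) →ₗ[k] H ⊗[k] H :=
  TensorProduct.map LinearMap.id
    (LinearMap.mul' k H ∘ₗ TensorProduct.map (LinearMap.mulRight k q.beta) q.alphaContr)

@[simp] theorem snakeContr_tmul (x y z w : H) :
    q.snakeContr (x ⊗ₜ (y ⊗ₜ (z ⊗ₜ w))) = x ⊗ₜ (y * q.beta * (q.S z * (q.alpha * w))) := rfl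

theorem snakeContr_mul_comulMid (t : H ⊗[k] (H ⊗[k] H)) (s : H ⊗[k] (H ⊗[k] (H ⊗[k] H))) :
    q.snakeContr (s * idTensor q.comulFst t) =
      q.snakeContr (s * insertMid (idTensor q.counitFst t)) := by
  induction t using tensor_induction₃ with
  | hadd t t' ht ht' => simp only [map_add, mul_add, ht, ht']
  | hpure x y z =>
    induction s using tensor_induction₄ with
    | hadd s s' hs hs' => simp only [map_add, add_mul, hs, hs']
    | hpure a b c d =>
      have h (e : H ⊗[k] H) :
          q.snakeContr ((a ⊗ₜ (b ⊗ₜ (c ⊗ₜ d))) *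
              (x ⊗ₜ Algebra.TensorProduct.assoc k k k H H H (e ⊗ₜ z))) =
            (a * x) ⊗ₜ[k] (b * (q.betaContr e * (q.S c * (q.alpha * (d * z))))) := by
        induction e with
        | zero => simp
        | add e e' he he' =>
          simp only [TensorProduct.add_tmul, TensorProduct.tmul_add, map_add, add_mul, mul_add,
            he, he']
        | tmul v w => simp [q.S_mul, mul_assoc]
      rw [idTensor_tmul, comulFst_tmul, h, betaContr_comul]
      simp [mul_assoc]

theorem snakeContr_comulEnd_mul (t : H ⊗[k] (H ⊗[k] H)) (s : H ⊗[k] (H ⊗[k] (H ⊗[k] H))) :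
    q.snakeContr (idTensor (idTensor q.comul) t * s) =
      q.snakeContr (insertEnd (idTensor q.counitSnd t) * s) := by
  induction t using tensor_induction₃ with
  | hadd t t' ht ht' => simp only [map_add, add_mul, ht, ht']
  | hpure x y z =>
    induction s using tensor_induction₄ with
    | hadd s s' hs hs' => simp only [map_add, mul_add, hs, hs']
    | hpure a b c d =>
      have h (e : H ⊗[k] H) :
          q.snakeContr ((x ⊗ₜ (y ⊗ₜ e)) * (a ⊗ₜ (b ⊗ₜ (c ⊗ₜ d)))) =
            (x * a) ⊗ₜ[k] (y * b * q.beta * (q.S c * (q.alphaContr e * d))) := by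
        induction e with
        | zero => simp
        | add e e' he he' =>
          simp only [TensorProduct.tmul_add, map_add, add_mul, mul_add, he, he']
        | tmul v w => simp [q.S_mul, mul_assoc]
      rw [idTensor_tmul, idTensor_tmul, h, alphaContr_comul]
      simp

/-! ### Identities for `p^R`, `q^R` and `q^L` -/

/-- `x ⊗ t ↦ x ⊗ t₁ β S(t₂)` -/
def betaSnd : H ⊗[k] (H ⊗[k] H) →ₗ[k] H ⊗[k] H := TensorProduct.map LinearMap.id q.betaContr

@[simp] theorem betaSnd_tmul (x y z : H) :
    q.betaSnd (x ⊗ₜ (y ⊗ₜ z)) = x ⊗ₜ (y * q.beta * q.S z) := rfl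

/-- `x ⊗ t ↦ x ⊗ S(t₁) α t₂` -/
def alphaSnd : H ⊗[k] (H ⊗[k] H) →ₗ[k] H ⊗[k] H := TensorProduct.map LinearMap.id q.alphaContr

@[simp] theorem alphaSnd_tmul (x y z : H) :
    q.alphaSnd (x ⊗ₜ (y ⊗ₜ z)) = x ⊗ₜ (q.S y * (q.alpha * z)) := rfl

theorem pRE_eq : q.pRE = q.betaSnd q.PhiInv := by
  simp [pRE, pR1, pR2, PhiInv]

theorem qLE_eq : q.qLE = q.alphaFst q.PhiInv := by
  simp [qLE, qL1, qL2, PhiInv, mul_assoc]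

theorem betaSnd_mul_comulSnd (s : H ⊗[k] (H ⊗[k] H)) (t : H ⊗[k] H) :
    q.betaSnd (s * idTensor q.comul t) = q.betaSnd s * (q.counitSnd t ⊗ₜ 1) := by
  induction t with
  | zero => simp
  | add t t' ht ht' => simp [mul_add, TensorProduct.add_tmul, ht, ht']
  | tmul x y =>
    induction s using tensor_induction₃ with
    | hadd s s' hs hs' => simp only [map_add, add_mul, hs, hs']
    | hpure a b c =>
      have h (e : H ⊗[k] H) : q.betaSnd ((a ⊗ₜ (b ⊗ₜ c)) * (x ⊗ₜ e)) =
          (a * x) ⊗ₜ[k] (b * (q.betaContr e * q.S c)) := by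
        induction e with
        | zero => simp
        | add e e' he he' =>
          simp only [TensorProduct.tmul_add, map_add, add_mul, mul_add, he, he']
        | tmul v w => simp [q.S_mul, mul_assoc]
      rw [idTensor_tmul, h, betaContr_comul]
      simp [TensorProduct.smul_tmul', mul_assoc]

/-- `n ⊗ m ↦ Δ(n) p^R (1 ⊗ S(m))` -/
def pRConj : H ⊗[k] H →ₗ[k] H ⊗[k] H :=
  LinearMap.mul' k (H ⊗[k] H) ∘ₗ
    TensorProduct.map (LinearMap.mulRight k q.pRE ∘ₗ q.comul.toLinearMap)
      ((includeRight : H →ₐ[k] H ⊗[k] H).toLinearMap ∘ₗ q.S)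

@[simp] theorem pRConj_tmul (x y : H) :
    q.pRConj (x ⊗ₜ y) = q.comul x * q.pRE * (1 ⊗ₜ q.S y) := rfl

theorem pRConj_comul (h : H) : q.pRConj (q.comul h) = q.pRE * (h ⊗ₜ 1) := by
  have h1 (t : H ⊗[k] H) (s : H ⊗[k] (H ⊗[k] H)) : q.betaSnd (q.comulFst t * s) =
      (LinearMap.mul' k (H ⊗[k] H) ∘ₗ
        TensorProduct.map (LinearMap.mulRight k (q.betaSnd s) ∘ₗ q.comul.toLinearMap)
        ((includeRight : H →ₐ[k] H ⊗[k] H).toLinearMap ∘ₗ q.S)) t := by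
    induction t with
    | zero => simp
    | add t t' ht ht' => simp only [map_add, add_mul, ht, ht']
    | tmul x y =>
      simp only [comulFst_tmul, LinearMap.comp_apply, TensorProduct.map_tmul,
        LinearMap.mul'_apply, LinearMap.mulRight_apply, AlgHom.toLinearMap_apply]
      generalize q.comul x = e
      induction e with
      | zero => simp
      | add e e' he he' => simp only [TensorProduct.add_tmul, map_add, add_mul, he, he']
      | tmul v w =>
        induction s using tensor_induction₃ with
        | hadd s s' hs hs' => simp only [map_add, mul_add, add_mul, hs, hs']
        | hpure a b c => simp [q.S_mul, mul_assoc]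
  rw [pRConj, pRE_eq, ← h1, ← comul_coassoc_inv, betaSnd_mul_comulSnd, counitSnd_comul]

theorem pRConj_mul_comul (r : H ⊗[k] H) (h : H) :
    q.pRConj (r * q.comul h) = q.pRConj r * (h ⊗ₜ 1) := by
  induction r with
  | zero => simp
  | add r r' hr hr' => simp only [map_add, add_mul, hr, hr']
  | tmul x y =>
    have h1 (e : H ⊗[k] H) : q.pRConj ((x ⊗ₜ y) * e) =
        q.comul x * q.pRConj e * (1 ⊗ₜ q.S y) := by
      induction e with
      | zero => simp
      | add e e' he he' => simp only [map_add, add_mul, mul_add, he, he']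
      | tmul v w =>
        simp [q.S_mul, mul_assoc]
    rw [h1, pRConj_comul, pRConj_tmul]
    simp [mul_assoc]

theorem comulFst_Phi_mul_tmulOne_PhiInv :
    q.comulFst q.Phi * tmulOne q.PhiInv =
      idTensor (idTensor q.comul) q.PhiInv * oneTmul q.Phi * idTensor q.comulFst q.Phi := by
  have h := congrArg (fun t => idTensor (idTensor q.comul) q.PhiInv * t * tmulOne q.PhiInv)
    q.pentagon_legs
  simp only [← mul_assoc, map_PhiInv_mul_Phi, one_mul] at h
  rw [h, mul_assoc _ (tmulOne q.Phi), map_Phi_mul_PhiInv, mul_one]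

theorem pRConj_qRE : q.pRConj q.qRE = 1 := by
  have h1 : q.pRConj q.qRE = q.snakeContr (q.comulFst q.Phi * tmulOne q.PhiInv) := by
    rw [qRE, Phi, map_sum, map_sum, Finset.sum_mul, map_sum]
    refine Finset.sum_congr rfl fun c _ => ?_
    simp only [pRConj_tmul, pRE_eq, comulFst_tmul]
    have h2 : q.S (q.qR2 c) = q.S (q.P2 c) * (q.alpha * q.P3 c) := by
      simp [qR2, q.S_mul, q.S_Sinv]
    rw [h2, qR1]
    generalize q.comul (q.P1 c) = e
    generalize q.PhiInv = s
    induction e with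
    | zero => simp
    | add e e' he he' => simp only [TensorProduct.add_tmul, map_add, add_mul, he, he']
    | tmul v w =>
      induction s using tensor_induction₃ with
      | hadd s s' hs hs' => simp only [map_add, mul_add, add_mul, hs, hs']
      | hpure a b c => simp [q.S_mul, mul_assoc]
  rw [h1, comulFst_Phi_mul_tmulOne_PhiInv, snakeContr_mul_comulMid, counit_mid_Phi, map_one,
    mul_one, snakeContr_comulEnd_mul, q.map_PhiInv_eq_one _ q.counit_thd_Phi, map_one, one_mul]
  simp only [Phi, oneTmul_apply, map_sum, snakeContr_tmul]
  rw [← TensorProduct.tmul_sum, Algebra.TensorProduct.one_def]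
  congr 1
  simpa [mul_assoc] using q.nondeg_1

theorem pRConj_qRE_mul_comul (h : H) : q.pRConj (q.qRE * q.comul h) = h ⊗ₜ 1 := by
  rw [pRConj_mul_comul, pRConj_qRE, one_mul]

/-- `x ⊗ y ↦ (S(x) ⊗ 1) q^L Δ(y)` -/
def qLConj : H ⊗[k] H →ₗ[k] H ⊗[k] H :=
  LinearMap.mul' k (H ⊗[k] H) ∘ₗ
    TensorProduct.map ((includeLeft : H →ₐ[k] H ⊗[k] H).toLinearMap ∘ₗ q.S)
      (LinearMap.mulLeft k q.qLE ∘ₗ q.comul.toLinearMap)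

@[simp] theorem qLConj_tmul (x y : H) :
    q.qLConj (x ⊗ₜ y) = (q.S x ⊗ₜ 1) * (q.qLE * q.comul y) := rfl

theorem qLConj_comul (h : H) : q.qLConj (q.comul h) = (1 ⊗ₜ h) * q.qLE := by
  have h1 (t : H ⊗[k] H) (s : H ⊗[k] (H ⊗[k] H)) : q.alphaFst (s * idTensor q.comul t) =
      (LinearMap.mul' k (H ⊗[k] H) ∘ₗ
        TensorProduct.map ((includeLeft : H →ₐ[k] H ⊗[k] H).toLinearMap ∘ₗ q.S)
        (LinearMap.mulLeft k (q.alphaFst s) ∘ₗ q.comul.toLinearMap)) t := by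
    induction t with
    | zero => simp
    | add t t' ht ht' => simp only [map_add, mul_add, ht, ht']
    | tmul x y =>
      simp only [idTensor_tmul, LinearMap.comp_apply, TensorProduct.map_tmul,
        LinearMap.mul'_apply, LinearMap.mulLeft_apply, AlgHom.toLinearMap_apply]
      generalize q.comul y = e
      induction e with
      | zero => simp
      | add e e' he he' => simp only [TensorProduct.tmul_add, map_add, mul_add, he, he']
      | tmul v w =>
        induction s using tensor_induction₃ with
        | hadd s s' hs hs' => simp only [map_add, mul_add, add_mul, hs, hs']
        | hpure a b c => simp [q.S_mul, mul_assoc]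
  rw [qLConj, qLE_eq, ← h1, comul_coassoc_inv, alphaFst_comulFst_mul, counitFst_comul]

theorem qLConj_comul_mul (h : H) (t : H ⊗[k] H) :
    q.qLConj (q.comul h * t) = (1 ⊗ₜ h) * q.qLConj t := by
  induction t with
  | zero => simp
  | add t t' ht ht' => simp only [map_add, mul_add, ht, ht']
  | tmul x y =>
    have h1 (e : H ⊗[k] H) : q.qLConj (e * (x ⊗ₜ y)) =
        (q.S x ⊗ₜ 1) * q.qLConj e * q.comul y := by
      induction e with
      | zero => simp
      | add e e' he he' => simp only [map_add, add_mul, mul_add, he, he']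
      | tmul v w =>
        rw [Algebra.TensorProduct.tmul_mul_tmul, qLConj_tmul, qLConj_tmul, q.S_mul, map_mul,
          ← mul_one (1 : H), ← Algebra.TensorProduct.tmul_mul_tmul]
        simp only [mul_assoc, mul_one]
    rw [h1, qLConj_comul, qLConj_tmul]
    simp only [← mul_assoc, Algebra.TensorProduct.tmul_mul_tmul, one_mul, mul_one]

/-! ### The contraction `G(x ⊗ w) = φ1 x₍₁₎ ⊗ S(φ2 x₍₂₎) α φ3 w` -/

/-- `x ⊗ w ↦ φ1 x₍₁₎ ⊗ S(φ2 x₍₂₎) α φ3 w` -/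
def phiContr : H ⊗[k] H →ₗ[k] H ⊗[k] H :=
  q.alphaSnd ∘ₗ LinearMap.mulLeft k q.Phi ∘ₗ q.comulFst.toLinearMap

theorem phiContr_apply (g : H ⊗[k] H) : q.phiContr g = q.alphaSnd (q.Phi * q.comulFst g) := rfl

theorem alphaSnd_comulSnd_mul (t : H ⊗[k] H) (s : H ⊗[k] (H ⊗[k] H)) :
    q.alphaSnd (idTensor q.comul t * s) = (q.counitSnd t ⊗ₜ 1) * q.alphaSnd s := by
  induction t with
  | zero => simp
  | add t t' ht ht' => simp [add_mul, TensorProduct.add_tmul, ht, ht']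
  | tmul x y =>
    induction s using tensor_induction₃ with
    | hadd s s' hs hs' => simp only [map_add, mul_add, hs, hs']
    | hpure a b c =>
      have h (e : H ⊗[k] H) : q.alphaSnd ((x ⊗ₜ e) * (a ⊗ₜ (b ⊗ₜ c))) =
          (x * a) ⊗ₜ[k] (q.S b * (q.alphaContr e * c)) := by
        induction e with
        | zero => simp
        | add e e' he he' =>
          simp only [TensorProduct.tmul_add, map_add, add_mul, mul_add, he, he']
        | tmul v w => simp [q.S_mul, mul_assoc]
      rw [idTensor_tmul, h, alphaContr_comul]
      simp [TensorProduct.smul_tmul']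

theorem phiContr_comul_mul (c : H) (g : H ⊗[k] H) :
    q.phiContr (q.comul c * g) = (c ⊗ₜ 1) * q.phiContr g := by
  rw [phiContr_apply, map_mul q.comulFst, ← mul_assoc, ← comul_coassoc, mul_assoc,
    alphaSnd_comulSnd_mul, counitSnd_comul, phiContr_apply]

theorem tmulOne_Phi_mul_comulFst_PhiInv :
    tmulOne q.Phi * q.comulFst q.PhiInv =
      idTensor q.comulFst q.PhiInv * oneTmul q.PhiInv * idTensor (idTensor q.comul) q.Phi := by
  have h := congrArg (fun t => idTensor q.comulFst q.PhiInv * (oneTmul q.PhiInv * t) *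
    q.comulFst q.PhiInv) q.pentagon_legs
  simp only [← mul_assoc] at h
  rw [mul_assoc _ (q.comulFst q.Phi), map_Phi_mul_PhiInv, mul_one,
    mul_assoc _ (oneTmul q.PhiInv) (oneTmul q.Phi), map_PhiInv_mul_Phi, mul_one,
    map_PhiInv_mul_Phi, one_mul] at h
  exact h.symm

theorem phiContr_pRE : q.phiContr q.pRE = 1 := by
  have h1 (s t : H ⊗[k] (H ⊗[k] H)) : q.alphaSnd (s * q.comulFst (q.betaSnd t)) =
      q.starContr (tmulOne s * q.comulFst t * (1 ⊗ₜ (1 ⊗ₜ (q.beta ⊗ₜ 1)))) := by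
    induction s using tensor_induction₃ with
    | hadd s s' hs hs' => simp only [map_add, add_mul, hs, hs']
    | hpure a b c =>
      induction t using tensor_induction₃ with
      | hadd t t' ht ht' => simp only [map_add, add_mul, mul_add, ht, ht']
      | hpure x y z =>
        rw [betaSnd_tmul, comulFst_tmul, comulFst_tmul]
        generalize q.comul x = e
        induction e with
        | zero => simp
        | add e e' he he' =>
          simp only [TensorProduct.add_tmul, map_add, mul_add, add_mul, he, he']
        | tmul v w => simp [q.S_mul, mul_assoc]
  rw [phiContr_apply, pRE_eq, h1, tmulOne_Phi_mul_comulFst_PhiInv, starContr_mul_comulEnd,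
    counit_thd_Phi, map_one, mul_one, mul_assoc, starContr_comulMid_mul,
    q.map_PhiInv_eq_one _ q.counit_mid_Phi, map_one, one_mul]
  simp only [PhiInv, map_sum, Finset.sum_mul, oneTmul_apply, Algebra.TensorProduct.tmul_mul_tmul,
    starContr_tmul, mul_one]
  rw [← TensorProduct.tmul_sum, Algebra.TensorProduct.one_def]
  congr 1
  simpa [mul_assoc] using q.nondeg_2

/-- `x ⊗ y ↦ x ⊗ S(y)` -/
def antipodeSnd : H ⊗[k] H →ₗ[k] H ⊗[k] H := TensorProduct.map LinearMap.id q.S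

@[simp] theorem antipodeSnd_tmul (x y : H) : q.antipodeSnd (x ⊗ₜ y) = x ⊗ₜ q.S y := rfl

theorem phiContr_pRE_mul (x w : H) :
    q.phiContr (q.pRE * (x ⊗ₜ w)) = q.antipodeSnd (q.comul x) * (1 ⊗ₜ w) := by
  have h (s : H ⊗[k] (H ⊗[k] H)) : q.alphaSnd (s * q.comulFst (x ⊗ₜ w)) =
      ∑ i ∈ Finset.range (q.n x), TensorProduct.map (LinearMap.mulRight k (q.d1 x i))
        (LinearMap.mulLeft k (q.S (q.d2 x i)) ∘ₗ LinearMap.mulRight k w) (q.alphaSnd s) := by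
    induction s using tensor_induction₃ with
    | hadd s s' hs hs' => simp only [map_add, add_mul, hs, hs', Finset.sum_add_distrib]
    | hpure a b c => simp [comulFst_tmul_sum, Finset.mul_sum, q.S_mul, mul_assoc]
  rw [phiContr_apply, map_mul q.comulFst, ← mul_assoc, h, ← phiContr_apply, phiContr_pRE]
  simp [Algebra.TensorProduct.one_def, q.comul_eq x, Finset.sum_mul]

/-- `x ⊗ y ↦ x b y` -/
def sandwich (b : H) : H ⊗[k] H →ₗ[k] H :=
  LinearMap.mul' k H ∘ₗ TensorProduct.map (LinearMap.mulRight k b) LinearMap.id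

@[simp] theorem sandwich_tmul (b x y : H) : sandwich b (x ⊗ₜ[k] y) = x * b * y := rfl

theorem sandwich_phiContr_mul (b y : H) (g : H ⊗[k] H) :
    sandwich b (q.phiContr (g * (y ⊗ₜ 1))) = sandwich (q.ad y b) (q.phiContr g) := by
  rw [phiContr_apply, phiContr_apply, map_mul q.comulFst, ← mul_assoc]
  generalize q.Phi * q.comulFst g = s
  induction s using tensor_induction₃ with
  | hadd s s' hs hs' => simp only [map_add, add_mul, hs, hs']
  | hpure u v w =>
    simp [comulFst_tmul_sum, Finset.mul_sum, Finset.sum_mul, ad, q.S_mul, mul_assoc]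

/-! ### Evaluating the contraction on the inverse twist -/

theorem sswap_mul (x y : H ⊗[k] H) : q.sswap (x * y) = q.sswap y * q.sswap x := by
  induction x with
  | zero => simp
  | add x x' hx hx' => simp only [map_add, add_mul, mul_add, hx, hx']
  | tmul a b =>
    induction y with
    | zero => simp
    | add y y' hy hy' => simp only [map_add, add_mul, mul_add, hy, hy']
    | tmul c d => simp [sswap, q.S_mul]

theorem scop_eq (x : H) : q.scop x = q.sswap (q.comul x) := by
  simp [scop, sswap, q.comul_eq x]

theorem bEl_eq : q.bEl = ∑ a ∈ Finset.range q.np,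
    q.comul (q.P1 a) * (q.pRE * ((q.beta ⊗ₜ 1) * q.sswap (q.P2 a ⊗ₜ q.P3 a))) := by
  rw [bEl]
  refine Finset.sum_congr rfl fun a _ => ?_
  rw [Finset.sum_comm, q.comul_eq (q.P1 a), Finset.sum_mul]
  refine Finset.sum_congr rfl fun m _ => ?_
  simp [pRE, pR1, pR2, sswap, Finset.sum_mul, Finset.mul_sum, q.S_mul, mul_assoc]

/-- `t₁ ⊗ t ↦ (t₁ ⊗ 1) G(p^R (β ⊗ 1) (S ⊗ S)((r t)₂₁))` -/
def twistContr (r : H ⊗[k] H) : H ⊗[k] (H ⊗[k] H) →ₗ[k] H ⊗[k] H :=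
  LinearMap.mul' k (H ⊗[k] H) ∘ₗ TensorProduct.map
    (includeLeft : H →ₐ[k] H ⊗[k] H).toLinearMap
    (q.phiContr ∘ₗ LinearMap.mulLeft k q.pRE ∘ₗ LinearMap.mulLeft k (q.beta ⊗ₜ 1) ∘ₗ
      q.sswap ∘ₗ LinearMap.mulLeft k r)

theorem twistContr_tmul (r : H ⊗[k] H) (x : H) (s : H ⊗[k] H) :
    q.twistContr r (x ⊗ₜ s) =
      (x ⊗ₜ 1) * q.phiContr (q.pRE * ((q.beta ⊗ₜ 1) * q.sswap (r * s))) := rfl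

theorem comulEnd_PhiInv_mul_oneTmul_Phi :
    idTensor (idTensor q.comul) q.PhiInv * oneTmul q.Phi =
      q.comulFst q.Phi * (tmulOne q.PhiInv * idTensor q.comulFst q.PhiInv) := by
  rw [← mul_assoc, comulFst_Phi_mul_tmulOne_PhiInv, mul_assoc _ (idTensor q.comulFst q.Phi),
    map_Phi_mul_PhiInv, mul_one]

theorem phiContr_twistInv_mul (r : H ⊗[k] H) :
    q.phiContr (q.twistInv * q.sswap r) =
      q.twistContr r (q.alphaFst (tmulOne q.PhiInv * idTensor q.comulFst q.PhiInv)) := by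
  have h1 : q.alphaFst (tmulOne q.PhiInv * idTensor q.comulFst q.PhiInv) =
      ∑ b ∈ Finset.range q.nq, ∑ a ∈ Finset.range q.np,
        (q.qL1 b * q.P1 a) ⊗ₜ[k] (q.comul (q.qL2 b) * (q.P2 a ⊗ₜ[k] q.P3 a)) := by
    have h2 := congrArg q.alphaFst q.comulEnd_PhiInv_mul_oneTmul_Phi
    rw [alphaFst_comulFst_mul, counit_fst_Phi, ← Algebra.TensorProduct.one_def, one_mul] at h2
    rw [← h2, Phi, PhiInv, map_sum, map_sum, Finset.sum_mul_sum, map_sum]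
    refine Finset.sum_congr rfl fun b _ => ?_
    rw [map_sum]
    refine Finset.sum_congr rfl fun a _ => ?_
    simp [qL1, qL2, mul_assoc]
  rw [h1, twistInv, bEl_eq, Finset.sum_mul, map_sum, map_sum]
  refine Finset.sum_congr rfl fun b _ => ?_
  rw [Finset.mul_sum, Finset.sum_mul, Finset.sum_mul, map_sum, map_sum]
  refine Finset.sum_congr rfl fun a _ => ?_
  rw [twistContr_tmul, scop_eq, sswap_mul, sswap_mul, ← phiContr_comul_mul, map_mul q.comul]
  simp only [mul_assoc]

theorem twistContr_tmul_alphaFst (n m : H) (t : H ⊗[k] (H ⊗[k] H)) :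
    q.twistContr (n ⊗ₜ m) (q.alphaFst (tmulOne q.PhiInv * idTensor q.comulFst t)) =
      q.antipodeSnd ((1 ⊗ₜ n) * q.qLConj (q.betaSnd t * (1 ⊗ₜ q.S m))) := by
  induction t using tensor_induction₃ with
  | hadd t t' ht ht' => simp only [map_add, add_mul, mul_add, ht, ht']
  | hpure x y z =>
    have hβ : q.comul (y * q.beta * q.S z * q.S m) =
        q.comul y * q.comul (q.beta * q.S (m * z)) := by
      rw [← map_mul, q.S_mul]; simp only [mul_assoc]
    rw [betaSnd_tmul, Algebra.TensorProduct.tmul_mul_tmul, mul_one, qLConj_tmul, qLE_eq, hβ,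
      idTensor_tmul, comulFst_tmul]
    generalize q.PhiInv = s
    generalize q.comul y = e
    induction s using tensor_induction₃ with
    | hadd s s' hs hs' => simp only [map_add, add_mul, mul_add, hs, hs']
    | hpure u v w =>
      induction e with
      | zero => simp
      | add e e' he he' =>
        simp only [TensorProduct.add_tmul, TensorProduct.tmul_add, map_add, add_mul, mul_add,
          he, he']
      | tmul c d =>
        have hs : q.sswap ((n * (w * d)) ⊗ₜ (m * z)) =
          q.S (m * z) ⊗ₜ q.S (n * (w * d)) := rfl
        simp only [tmulOne_tmul, Algebra.TensorProduct.assoc_tmul,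
          Algebra.TensorProduct.tmul_mul_tmul, alphaFst_tmul, twistContr_tmul, one_mul,
          hs, phiContr_pRE_mul]
        generalize q.comul (q.beta * q.S (m * z)) = f
        induction f with
        | zero => simp
        | add f f' hf hf' => simp only [map_add, add_mul, mul_add, hf, hf']
        | tmul f f' => simp [q.S_mul, mul_assoc]

theorem phiContr_twistInv_mul_sswap (r : H ⊗[k] H) :
    q.phiContr (q.twistInv * q.sswap r) = q.antipodeSnd (q.qLConj (q.pRConj r)) := by
  induction r with
  | zero => simp
  | add r r' hr hr' => simp only [map_add, mul_add, hr, hr']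
  | tmul n m =>
    rw [phiContr_twistInv_mul, twistContr_tmul_alphaFst, pRConj_tmul, mul_assoc, qLConj_comul_mul,
      pRE_eq]

theorem phiContr_twistInv_mul_sswap_qRE (h : H) :
    q.phiContr (q.twistInv * q.sswap (q.qRE * q.comul h)) =
      q.antipodeSnd ((q.S h ⊗ₜ 1) * q.qLE) := by
  rw [phiContr_twistInv_mul_sswap, pRConj_qRE_mul_comul, qLConj_tmul, map_one, mul_one]

/-! ### The product of the adjoint algebra -/

/-- `x ⊗ y ⊗ z ⊗ w ↦ x a S(y) α z b S(w)` -/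
def starMap (a b : H) : H ⊗[k] (H ⊗[k] (H ⊗[k] H)) →ₗ[k] H :=
  LinearMap.mul' k H ∘ₗ TensorProduct.map (LinearMap.mulRight k a)
    (LinearMap.mul' k H ∘ₗ TensorProduct.map q.S (LinearMap.mulLeft k q.alpha ∘ₗ
      LinearMap.mul' k H ∘ₗ TensorProduct.map (LinearMap.mulRight k b) q.S))

@[simp] theorem starMap_tmul (a b x y z w : H) :
    q.starMap a b (x ⊗ₜ (y ⊗ₜ (z ⊗ₜ w))) =
      x * a * (q.S y * (q.alpha * (z * b * q.S w))) := rfl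

theorem star_eq (a b : H) :
    q.star a b = q.starMap a b (oneTmul q.PhiInv * idTensor (idTensor q.comul) q.Phi) := by
  rw [Phi, PhiInv, map_sum, map_sum, Finset.sum_mul_sum, Finset.sum_comm, star, map_sum]
  refine Finset.sum_congr rfl fun c _ => ?_
  rw [map_sum]
  refine Finset.sum_congr rfl fun e _ => ?_
  simp [q.comul_eq (q.P3 c), TensorProduct.tmul_sum, Finset.mul_sum, mul_assoc]

theorem star_ad_mul (b u w z : H) :
    q.star (q.ad u b) (w * q.S z) =
      sandwich b (q.starContr (oneTmul q.PhiInv * idTensor (idTensor q.comul) q.Phi *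
        q.comulFst (u ⊗ₜ (w ⊗ₜ z)))) := by
  rw [star_eq]
  generalize oneTmul q.PhiInv * idTensor (idTensor q.comul) q.Phi = t
  induction t using tensor_induction₄ with
  | hadd t t' ht ht' => simp only [map_add, add_mul, ht, ht']
  | hpure x y z w =>
    simp [comulFst_tmul_sum, ad, Finset.mul_sum, Finset.sum_mul, q.S_mul, mul_assoc]

/-- `u ⊗ w ↦ (u ▷ b) ⋆ w` -/
def starAd (b : H) : H ⊗[k] H →ₗ[k] H :=
  sandwich b ∘ₗ q.starContr ∘ₗ
    LinearMap.mulLeft k (oneTmul q.PhiInv * idTensor (idTensor q.comul) q.Phi) ∘ₗ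
      q.comulFst.toLinearMap ∘ₗ (idTensor includeLeft : H ⊗[k] H →ₐ[k] _).toLinearMap

@[simp] theorem starAd_tmul (b u w : H) : q.starAd b (u ⊗ₜ w) = q.star (q.ad u b) w := by
  have h := q.star_ad_mul b u w 1
  rw [q.S_one, mul_one] at h
  exact h.symm

theorem starAd_phi_conj (b : H) (g : H ⊗[k] H) :
    q.starAd b (∑ c ∈ Finset.range q.np,
      (q.P1 c ⊗ₜ q.P2 c) * g * (1 ⊗ₜ q.S (q.P3 c))) = sandwich b (q.phiContr g) := by
  have hpent : oneTmul q.PhiInv * idTensor (idTensor q.comul) q.Phi * q.comulFst q.Phi =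
      idTensor q.comulFst q.Phi * tmulOne q.Phi := by
    rw [mul_assoc, pentagon_legs, ← mul_assoc, ← mul_assoc, map_PhiInv_mul_Phi, one_mul]
  have hcontr (t : H ⊗[k] (H ⊗[k] H)) : q.starContr (tmulOne t) = q.alphaSnd t := by
    induction t using tensor_induction₃ with
    | hadd t t' ht ht' => simp only [map_add, ht, ht']
    | hpure x y z => simp [q.S_one]
  induction g with
  | zero => simp
  | add g g' hg hg' =>
    simp only [map_add, mul_add, add_mul, Finset.sum_add_distrib, hg, hg']
  | tmul u w =>
    have hcomul : q.comulFst (u ⊗ₜ (w ⊗ₜ[k] (1 : H))) = tmulOne (q.comulFst (u ⊗ₜ w)) := by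
      simp [comulFst_tmul_sum]
    have hsum : q.comulFst (q.Phi * (u ⊗ₜ (w ⊗ₜ[k] (1 : H)))) = ∑ c ∈ Finset.range q.np,
        q.comulFst ((q.P1 c ⊗ₜ (q.P2 c ⊗ₜ q.P3 c)) * (u ⊗ₜ (w ⊗ₜ 1))) := by
      rw [Phi, Finset.sum_mul, map_sum]
    calc _ = ∑ c ∈ Finset.range q.np, sandwich b (q.starContr
          (oneTmul q.PhiInv * idTensor (idTensor q.comul) q.Phi *
            q.comulFst ((q.P1 c ⊗ₜ (q.P2 c ⊗ₜ q.P3 c)) * (u ⊗ₜ (w ⊗ₜ 1))))) := by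
          simp only [map_sum, Algebra.TensorProduct.tmul_mul_tmul, mul_one, starAd_tmul,
            star_ad_mul]
      _ = sandwich b (q.starContr (oneTmul q.PhiInv * idTensor (idTensor q.comul) q.Phi *
            q.comulFst (q.Phi * (u ⊗ₜ (w ⊗ₜ 1))))) := by
          rw [hsum, Finset.mul_sum, map_sum, map_sum]
      _ = sandwich b (q.phiContr (u ⊗ₜ w)) := by
          rw [map_mul q.comulFst, ← mul_assoc, hpent, mul_assoc, starContr_comulMid_mul, counit_mid_Phi,
            map_one, one_mul, hcomul, ← map_mul tmulOne, hcontr, phiContr_apply]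

theorem deltaOne_eq (a : H) :
    q.deltaOne a = ∑ c ∈ Finset.range q.np, (q.P1 c ⊗ₜ q.P2 c) *
      (∑ c' ∈ Finset.range q.np, q.comul (q.P1 c' * a) *
        (q.twistInv * q.sswap (q.qRE * q.comul (q.P2 c'))) * (q.P3 c' ⊗ₜ 1)) *
      (1 ⊗ₜ q.S (q.P3 c)) := by
  rw [deltaOne]
  refine Finset.sum_congr rfl fun c _ => ?_
  rw [Finset.mul_sum, Finset.sum_mul]
  refine Finset.sum_congr rfl fun c' _ => ?_
  have h : q.sswap (q.qRE * q.comul (q.P2 c')) =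
      ∑ e ∈ Finset.range q.np, ∑ m ∈ Finset.range (q.n (q.P2 c')),
        q.S (q.qR2 e * q.d2 (q.P2 c') m) ⊗ₜ[k] q.S (q.qR1 e * q.d1 (q.P2 c') m) := by
    simp [qRE, q.comul_eq (q.P2 c'), Finset.sum_mul_sum, sswap]
  rw [h, map_mul, q.comul_eq (q.P1 c')]
  simp only [Finset.mul_sum, Finset.sum_mul]
  refine Finset.sum_congr rfl fun e _ => ?_
  rw [Finset.sum_comm]
  refine Finset.sum_congr rfl fun m2 _ => Finset.sum_congr rfl fun m1 _ => ?_
  simp only [mul_assoc, Algebra.TensorProduct.tmul_mul_tmul, mul_one, q.S_mul]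
  rw [← mul_assoc (q.P1 c ⊗ₜ[k] q.P2 c), Algebra.TensorProduct.tmul_mul_tmul]

theorem starAd_deltaOne (a b : H) : q.starAd b (q.deltaOne a) = q.star a b := by
  rw [deltaOne_eq, starAd_phi_conj, map_sum, map_sum, star]
  refine Finset.sum_congr rfl fun c _ => ?_
  rw [sandwich_phiContr_mul, phiContr_comul_mul, phiContr_twistInv_mul_sswap_qRE]
  simp [qLE, qL1, qL2, ad, Finset.mul_sum, Finset.sum_mul, q.S_mul, mul_assoc]

end QuasiHopf

/-- Quantum commutativity of the adjoint algebra: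
for any decomposition `δ¹(a) = ∑ₜ uₜ ⊗ wₜ` one has
`∑ₜ (uₜ ▷ b) ⋆ wₜ = a ⋆ b`, i.e. `(a₍₋₁₎ ▷ b) ⋆ a₍₀₎ = a ⋆ b`. -/
theorem statement15 (k H : Type) [Field k] [Ring H] [Algebra k H] (q : QuasiHopf k H) :
    ∀ (a b : H) (N : ℕ) (u w : ℕ → H),
      (∑ t ∈ Finset.range N, u t ⊗ₜ[k] w t) = q.deltaOne a →
      (∑ t ∈ Finset.range N, q.star (q.ad (u t) b) (w t)) = q.star a b := by
  intro a b N u w h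
  rw [← q.starAd_deltaOne a b, ← h, map_sum]
  simp only [QuasiHopf.starAd_tmul]
end
end

section
/- Let H be a quasi-Hopf algebra over a field k with bijective antipode S (inverse S̄), μ : H → k an algebra map, and g a pivotal element of H. Suppose λ ∈ H* satisfies λ(xy) = λ(y·S(S(x) ↼ μ)) for all x, y ∈ H, where h ↼ μ = μ(h_(1))h_(2). Then the linear form t ∈ H* defined by t(h) = λ(S̄(gh)) is μ-symmetric: t(hh') = t((h' ↼ μ)·h) for all h, h' ∈ H. -/
open scoped TensorProduct

noncomputable section

/-- Let `g` be a pivotal element and suppose `λ ∈ H*` has the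
Nakayama property `λ(xy) = λ(y S(S(x) ↼ μ))`.  Then `t(h) = λ(S̄(g h))` is
`μ`-symmetric: `t(h h') = t((h' ↼ μ) h)`. -/
theorem statement18 (k H : Type) [Field k] [Ring H] [Algebra k H] (q : QuasiHopf k H)
    (mu : H →ₐ[k] k) (g gi : H) (hg1 : g * gi = 1) (hg2 : gi * g = 1)
    (hpiv : ∀ h : H, g * h * gi = q.S (q.S h))
    (hDg : q.comul g = q.twistInv * q.sswap q.twist * (g ⊗ₜ[k] g))
    (lam : H →ₗ[k] k)
    (hnak : ∀ x y : H, lam (x * y) = lam (y * q.S (q.lhook mu (q.S x)))) :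
    ∀ h h' : H, lam (q.Sinv (g * (h * h'))) = lam (q.Sinv (g * (q.lhook mu h' * h))) := by
  intro h h'
  have Sinv_mul : ∀ x y : H, q.Sinv (x * y) = q.Sinv y * q.Sinv x := fun x y => by
    rw [← q.Sinv_S (q.Sinv y * q.Sinv x), q.S_mul, q.S_Sinv, q.S_Sinv]
  have g_mul : ∀ u : H, g * u = q.S (q.S u) * g := fun u => by
    rw [← hpiv, mul_assoc, hg2, mul_one]
  rw [← mul_assoc, Sinv_mul, hnak, q.S_Sinv, ← mul_assoc g (q.lhook mu h'),
    g_mul (q.lhook mu h'), mul_assoc, Sinv_mul (q.S _), q.Sinv_S]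
end
end
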